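/- Let n ≥ 2 be an integer, let m ≥ 0 be an even integer, and let μ ∈ (m, m+1). Then every Legendre function p for the pair (n, μ) satisfies p(0) · p'(0) > 0. -/

import Mathlib

open Real Set Filter

/-- `p` is a Legendre function for the pair `(n, μ)`, with derivative `p'` (denoted `p₁`):
`p` is `C¹` on `[0, π/2]`, `C²` on `[0, π/2)`, solves
`p'' - (n-2)·tan(φ)·p' + μ(μ+n-2)·p = 0` on `[0, π/2)`, and `p(π/2) = 1`, `p'(π/2) = 0`. -/
def IsLegendre (n : ℕ) (μ : ℝ) (p p₁ : ℝ → ℝ) : Prop :=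
  (∀ φ ∈ Set.Icc (0 : ℝ) (π / 2), HasDerivWithinAt p (p₁ φ) (Set.Icc 0 (π / 2)) φ) ∧
  ContinuousOn p₁ (Set.Icc 0 (π / 2)) ∧
  (∃ p₂ : ℝ → ℝ,
    (∀ φ ∈ Set.Ico (0 : ℝ) (π / 2), HasDerivWithinAt p₁ (p₂ φ) (Set.Ico 0 (π / 2)) φ) ∧
    ContinuousOn p₂ (Set.Ico 0 (π / 2)) ∧
    ∀ φ ∈ Set.Ico (0 : ℝ) (π / 2),
      p₂ φ - (n - 2 : ℝ) * Real.tan φ * p₁ φ + μ * (μ + n - 2) * p φ = 0) ∧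
  p (π / 2) = 1 ∧ p₁ (π / 2) = 0

/-- Lowering operator: from a Legendre function for `μ` to one for `μ - 1`. -/
lemma legendre_lower (n : ℕ) (μ : ℝ) (hμ : μ ≠ 0) (p p₁ : ℝ → ℝ) (hp : IsLegendre n μ p p₁) :
    IsLegendre n (μ - 1) (fun x => Real.sin x * p x + Real.cos x * p₁ x / μ)
      (fun x => (μ + n - 3) / μ * (Real.sin x * p₁ x - μ * (Real.cos x * p x))) := by
  obtain ⟨h1, h2, ⟨p₂, h3, h4, h5⟩, h6, h7⟩ := hp
  have hpc : ContinuousOn p (Set.Icc 0 (π / 2)) := fun x hx => (h1 x hx).continuousWithinAt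
  have hsub : Set.Ico (0 : ℝ) (π / 2) ⊆ Set.Icc 0 (π / 2) := Set.Ico_subset_Icc_self
  refine ⟨?_, ?_, ⟨fun x => (μ + n - 3) / μ * ((Real.cos x * p₁ x + Real.sin x * p₂ x)
      - μ * (-Real.sin x * p x + Real.cos x * p₁ x)), ?_, ?_, ?_⟩, ?_, ?_⟩
  · intro x hx
    have hs := (Real.hasDerivAt_sin x).hasDerivWithinAt (s := Set.Icc 0 (π / 2))
    have hc := (Real.hasDerivAt_cos x).hasDerivWithinAt (s := Set.Icc 0 (π / 2))
    rcases hx.2.lt_or_eq with hlt | heq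
    · have hx' : x ∈ Set.Ico (0 : ℝ) (π / 2) := ⟨hx.1, hlt⟩
      have hcos : Real.cos x ≠ 0 :=
        (Real.cos_pos_of_mem_Ioo ⟨by linarith [hx.1, Real.pi_pos], hlt⟩).ne'
      have h3' : HasDerivWithinAt p₁ (p₂ x) (Set.Icc 0 (π / 2)) x := by
        refine (h3 x hx').mono_of_mem_nhdsWithin ?_
        have : Set.Icc 0 (π / 2) ∩ Set.Iio (π / 2) ∈ nhdsWithin x (Set.Icc 0 (π / 2)) :=
          Filter.inter_mem self_mem_nhdsWithin (mem_nhdsWithin_of_mem_nhds (Iio_mem_nhds hlt))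
        exact Filter.mem_of_superset this fun y hy => ⟨hy.1.1, hy.2⟩
      have e := h5 x hx'
      rw [Real.tan_eq_sin_div_cos] at e
      refine ((hs.mul (h1 x hx)).add ((hc.mul h3').div_const μ)).congr_deriv ?_
      have e2 : p₂ x = (n - 2 : ℝ) * (Real.sin x / Real.cos x) * p₁ x
        - μ * (μ + n - 2) * p x := by linarith
      rw [e2]
      field_simp
      ring
    · subst heq
      have hcp : HasDerivWithinAt (fun x => Real.cos x * p₁ x) 0 (Set.Icc 0 (π / 2)) (π / 2) := by
        rw [hasDerivWithinAt_iff_tendsto_slope]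
        have a := hasDerivWithinAt_iff_tendsto_slope.1 hc
        have b : Filter.Tendsto p₁ (nhdsWithin (π / 2) (Set.Icc 0 (π / 2) \ {π / 2}))
            (nhds (p₁ (π / 2))) :=
          (h2 (π / 2) hx).mono_left (nhdsWithin_mono _ Set.sdiff_subset)
        have ab := a.mul b
        rw [h7, mul_zero] at ab
        refine ab.congr fun y => ?_
        simp [slope_def_field]
        ring
      refine ((hs.mul (h1 _ hx)).add (hcp.div_const μ)).congr_deriv ?_
      simp [h7]
  · fun_prop
  · intro x hx
    have hs := (Real.hasDerivAt_sin x).hasDerivWithinAt (s := Set.Ico 0 (π / 2))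
    have hc := (Real.hasDerivAt_cos x).hasDerivWithinAt (s := Set.Ico 0 (π / 2))
    exact ((hs.mul (h3 x hx)).sub ((hc.mul ((h1 x (hsub hx)).mono hsub)).const_mul μ)).const_mul _
  · have := hpc.mono hsub
    have := h2.mono hsub
    fun_prop
  · intro x hx
    have hcos : Real.cos x ≠ 0 :=
        (Real.cos_pos_of_mem_Ioo ⟨by linarith [hx.1, Real.pi_pos], hx.2⟩).ne'
    have e := h5 x hx
    have e2 : p₂ x = (n - 2 : ℝ) * Real.tan x * p₁ x - μ * (μ + n - 2) * p x := by linarith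
    simp only [e2]
    rw [Real.tan_eq_sin_div_cos]
    field_simp
    ring
  · simp [h6]
  · simp [h7]

lemma legendre_base (k : ℕ) (μ : ℝ) (hμ1 : 0 < μ) (hμ2 : μ < 1)
    (p p₁ : ℝ → ℝ) (hp : IsLegendre (k + 2) μ p p₁) : 0 < p 0 * p₁ 0 := by
  obtain ⟨h1, h2, ⟨p₂, h3, h4, h5⟩, h6, h7⟩ := hp
  have hpc : ContinuousOn p (Set.Icc 0 (π / 2)) := fun x hx => (h1 x hx).continuousWithinAt
  have hpi := Real.pi_pos
  have hk : (0 : ℝ) ≤ k := k.cast_nonneg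
  have d1 : ∀ x ∈ Set.Ioo (0 : ℝ) (π / 2), HasDerivAt p (p₁ x) x := fun x hx =>
    (h1 x ⟨hx.1.le, hx.2.le⟩).hasDerivAt (Icc_mem_nhds hx.1 hx.2)
  have d2 : ∀ x ∈ Set.Ioo (0 : ℝ) (π / 2), HasDerivAt p₁ (p₂ x) x := fun x hx =>
    (h3 x ⟨hx.1.le, hx.2⟩).hasDerivAt (Ico_mem_nhds hx.1 hx.2)
  have hcos : ∀ x ∈ Set.Ico (0 : ℝ) (π / 2), 0 < Real.cos x := fun x hx =>
    Real.cos_pos_of_mem_Ioo ⟨by linarith [hx.1], hx.2⟩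
  -- derivative of the weighted derivative
  have dw : ∀ x ∈ Set.Ioo (0 : ℝ) (π / 2), HasDerivAt (fun x => Real.cos x ^ k * p₁ x)
      (-(μ * (μ + k)) * (Real.cos x ^ k * p x)) x := by
    intro x hx
    have hc := hcos x ⟨hx.1.le, hx.2⟩
    have e := h5 x ⟨hx.1.le, hx.2⟩
    push_cast at e
    have e2 : p₂ x = k * Real.tan x * p₁ x - μ * (μ + k) * p x := by linarith
    refine (((Real.hasDerivAt_cos x).pow k).mul (d2 x hx)).congr_deriv ?_
    rw [e2, Real.tan_eq_sin_div_cos]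
    rcases k with _ | j
    · simp
    · simp only [Nat.add_sub_cancel, pow_succ, Pi.mul_apply, Pi.pow_apply]
      field_simp
      ring
  -- positivity of the derivative to the right of which p is positive
  have key1 : ∀ a ∈ Set.Ico (0 : ℝ) (π / 2), (∀ x ∈ Set.Ioo a (π / 2), 0 < p x) → 0 < p₁ a := by
    intro a ha hpos
    have hanti : StrictAntiOn (fun x => Real.cos x ^ k * p₁ x) (Set.Icc a (π / 2)) := by
      refine strictAntiOn_of_deriv_neg (convex_Icc _ _) ?_ ?_
      · have := h2.mono (Set.Icc_subset_Icc_left ha.1)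
        fun_prop
      · intro x hx
        rw [interior_Icc] at hx
        have hx0 : x ∈ Set.Ioo (0 : ℝ) (π / 2) := ⟨ha.1.trans_lt hx.1, hx.2⟩
        rw [(dw x hx0).deriv]
        have := hpos x hx
        have := hcos x ⟨hx0.1.le, hx0.2⟩
        have : 0 < (μ * (μ + k)) * (Real.cos x ^ k * p x) := by positivity
        linarith
    have := hanti ⟨le_rfl, ha.2.le⟩ ⟨ha.2.le, le_rfl⟩ ha.2
    simp only [h7, mul_zero] at this
    exact pos_of_mul_pos_right this (pow_pos (hcos a ha) k).le
  have key2 : ∀ a ∈ Set.Ico (0 : ℝ) (π / 2), (∀ x ∈ Set.Ioo a (π / 2), 0 < p x) →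
      p₁ a * Real.sin a - p a * Real.cos a < 0 := by
    intro a ha hpos
    have hmono : StrictMonoOn (fun x => Real.cos x ^ k * p₁ x * Real.sin x
        - Real.cos x ^ k * (p x * Real.cos x)) (Set.Icc a (π / 2)) := by
      refine strictMonoOn_of_deriv_pos (convex_Icc _ _) ?_ ?_
      · have := h2.mono (Set.Icc_subset_Icc_left ha.1)
        have := hpc.mono (Set.Icc_subset_Icc_left ha.1)
        fun_prop
      · intro x hx
        rw [interior_Icc] at hx
        have hx0 : x ∈ Set.Ioo (0 : ℝ) (π / 2) := ⟨ha.1.trans_lt hx.1, hx.2⟩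
        have hD : HasDerivAt (fun x => Real.cos x ^ k * p₁ x * Real.sin x
            - Real.cos x ^ k * (p x * Real.cos x))
            ((1 - μ) * (1 + μ + k) * (Real.cos x ^ k * p x * Real.sin x)) x := by
          refine (((dw x hx0).mul (Real.hasDerivAt_sin x)).sub
            (((Real.hasDerivAt_cos x).pow k).mul
              ((d1 x hx0).mul (Real.hasDerivAt_cos x)))).congr_deriv ?_
          rcases k with _ | j
          · simp
            ring
          · simp only [Nat.add_sub_cancel, pow_succ, Pi.mul_apply, Pi.pow_apply]
            push_cast
            ring
        rw [hD.deriv]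
        have := hpos x hx
        have := hcos x ⟨hx0.1.le, hx0.2⟩
        have := Real.sin_pos_of_pos_of_lt_pi hx0.1 (by linarith [hx0.2])
        have : 0 < 1 - μ := by linarith
        positivity
    have := hmono ⟨le_rfl, ha.2.le⟩ ⟨ha.2.le, le_rfl⟩ ha.2
    simp only [h7, Real.cos_pi_div_two, mul_zero, zero_mul, sub_zero] at this
    have h0 : Real.cos a ^ k * (p₁ a * Real.sin a - p a * Real.cos a) < 0 := by linarith
    exact (pos_iff_neg_of_mul_neg h0).1 (pow_pos (hcos a ha) k)
  have hall : ∀ x ∈ Set.Icc (0 : ℝ) (π / 2), 0 < p x := by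
    by_contra! hne
    obtain ⟨b, hb, hpb⟩ := hne
    have hcomp : IsCompact (Set.Icc (0 : ℝ) (π / 2) ∩ p ⁻¹' Set.Iic 0) :=
      isCompact_Icc.of_isClosed_subset
        (hpc.preimage_isClosed_of_isClosed isClosed_Icc isClosed_Iic) Set.inter_subset_left
    obtain ⟨a, ⟨haI, hpa⟩, hub⟩ := hcomp.exists_isGreatest ⟨b, hb, hpb⟩
    have hpa' : p a ≤ 0 := hpa
    have halt : a < π / 2 := by
      rcases haI.2.lt_or_eq with h | h
      · exact h
      · rw [h, h6] at hpa'
        linarith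
    have ha : a ∈ Set.Ico (0 : ℝ) (π / 2) := ⟨haI.1, halt⟩
    have hpos : ∀ x ∈ Set.Ioo a (π / 2), 0 < p x := by
      intro x hx
      by_contra! hle
      have := hub ⟨⟨haI.1.trans hx.1.le, hx.2.le⟩, hle⟩
      linarith [hx.1]
    have k1 := key1 a ha hpos
    have k2 := key2 a ha hpos
    have hc := hcos a ha
    have hs := Real.sin_nonneg_of_nonneg_of_le_pi ha.1 (by linarith)
    nlinarith [mul_nonneg k1.le hs, mul_nonneg (neg_nonneg.2 hpa') hc.le]
  have h0 : (0 : ℝ) ∈ Set.Ico (0 : ℝ) (π / 2) := ⟨le_rfl, by positivity⟩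
  exact mul_pos (hall 0 ⟨le_rfl, h0.2.le⟩)
    (key1 0 h0 fun x hx => hall x ⟨hx.1.le, hx.2.le⟩)

lemma legendre_sign (k : ℕ) (m : ℕ) : ∀ (μ : ℝ), (m : ℝ) < μ → μ < m + 1 →
    ∀ p p₁ : ℝ → ℝ, IsLegendre (k + 2) μ p p₁ → 0 < (-1) ^ m * (p 0 * p₁ 0) := by
  induction m with
  | zero =>
    intro μ h1 h2 p p₁ hp
    simpa using legendre_base k μ (by simpa using h1) (by simpa using h2) p p₁ hp
  | succ m ih =>
    intro μ h1 h2 p p₁ hp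
    push_cast at h1 h2
    have hm : (0 : ℝ) ≤ m := m.cast_nonneg
    have hk : (0 : ℝ) ≤ k := k.cast_nonneg
    have hμ : 0 < μ := by linarith
    have := ih (μ - 1) (by linarith) (by linarith) _ _ (legendre_lower (k + 2) μ hμ.ne' p p₁ hp)
    simp only [Real.sin_zero, Real.cos_zero, zero_mul, one_mul, zero_add, zero_sub] at this
    push_cast at this
    have hc : 0 < (μ + (k + 2) - 3) / μ := div_pos (by linarith) hμ
    have e : (-1 : ℝ) ^ m * (p₁ 0 / μ * ((μ + (k + 2) - 3) / μ * -(μ * p 0)))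
        = ((μ + (k + 2) - 3) / μ) * ((-1) ^ (m + 1) * (p 0 * p₁ 0)) := by
      rw [pow_succ]
      field_simp
    rw [e] at this
    exact pos_of_mul_pos_right this hc.le

/-- **Equation (2.8).** If `m` is even and `μ ∈ (m, m+1)`, then every Legendre function
for `(n, μ)` satisfies `p(0)·p'(0) > 0`. -/
theorem legendre_even_sign (n : ℕ) (hn : 2 ≤ n) (m : ℕ) (hm : Even m)
    (μ : ℝ) (hμ1 : (m : ℝ) < μ) (hμ2 : μ < m + 1)
    (p p₁ : ℝ → ℝ) (hp : IsLegendre n μ p p₁) :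
    0 < p 0 * p₁ 0 := by
  obtain ⟨k, rfl⟩ := Nat.exists_eq_add_of_le' hn
  have := legendre_sign k m μ hμ1 hμ2 p p₁ hp
  rwa [hm.neg_one_pow, one_mul] at this
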